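/- For any system of isometries 𝒦 = (K,𝒜) with associated ℝ-tree T_𝒦, the dual laminary language of T_𝒦 is contained in the admissible laminary language of 𝒦: ℒ_𝒜(T_𝒦) ⊆ ℒ_adm(𝒦). -/

import Mathlib

/-!
Common formalization framework for "ℝ-trees, dual laminations, and compact systems
of partial isometries" (Coulbois–Hilion–Lustig).
-/

open Set Filter Topology Pointwise

noncomputable section

namespace CHL

/-! ### ℝ-trees -/

/-- The metric betweenness segment `[x,y]`.  In an ℝ-tree this is exactly the unique
topological arc joining `x` to `y`, which is a geodesic segment. -/
def seg {T : Type*} [MetricSpace T] (x y : T) : Set T :=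
  {z | dist x z + dist z y = dist x y}

/-- An ℝ-tree: a geodesic metric space which is `0`-hyperbolic (four point condition).
Equivalently, any two points are joined by a unique topological arc, and this arc is a
geodesic segment. -/
class IsRTree (T : Type*) [MetricSpace T] : Prop where
  geodesic : ∀ x y : T, ∃ f : ℝ → T, f 0 = x ∧ f (dist x y) = y ∧
      ∀ s ∈ Set.Icc (0 : ℝ) (dist x y), ∀ t ∈ Set.Icc (0 : ℝ) (dist x y),
        dist (f s) (f t) = |s - t|
  four_point : ∀ x y z w : T,
      dist x y + dist z w ≤ max (dist x z + dist y w) (dist x w + dist y z)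

/-- A subtree of an ℝ-tree: a convex subset. -/
def IsSubtree {T : Type*} [MetricSpace T] (A : Set T) : Prop :=
  ∀ x ∈ A, ∀ y ∈ A, seg x y ⊆ A

/-- A non-empty closed subtree. -/
def IsClosedSubtree {T : Type*} [MetricSpace T] (A : Set T) : Prop :=
  A.Nonempty ∧ IsClosed A ∧ IsSubtree A

/-- The convex hull of a subset of an ℝ-tree: the smallest subtree containing it. -/
def subtreeHull {T : Type*} [MetricSpace T] (S : Set T) : Set T :=
  ⋂₀ {A : Set T | S ⊆ A ∧ IsSubtree A}

/-- A finite tree: the convex hull of finitely many points. -/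
def IsFiniteSubtree {T : Type*} [MetricSpace T] (A : Set T) : Prop :=
  ∃ F : Finset T, A = subtreeHull (F : Set T)

/-- `[x,x']` is the segment joining `A` to `B`: its endpoints are the only points
in `A` resp. `B` that it meets. -/
def IsBridge {T : Type*} [MetricSpace T] (A B : Set T) (x x' : T) : Prop :=
  x ∈ A ∧ x' ∈ B ∧ seg x x' ∩ A = {x} ∧ seg x x' ∩ B = {x'}

/-- A morphism of ℝ-trees: a continuous map such that every segment is mapped locally
injectively except at finitely many points. -/
def IsTreeMorphism {T T' : Type*} [MetricSpace T] [MetricSpace T'] (f : T → T') : Prop :=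
  Continuous f ∧ ∀ x y : T, ∃ F : Finset T, ∀ p ∈ seg x y, p ∉ (F : Set T) →
    ∃ U ∈ nhdsWithin p (seg x y), Set.InjOn f U

/-- The translation length `‖g‖_T = inf_{x ∈ T} d(x, gx)`. -/
def translationLength (G : Type*) [Group G] (T : Type*) [MetricSpace T] [MulAction G T]
    (g : G) : ℝ :=
  ⨅ x : T, dist x (g • x)

/-- The translation length of `g` on an invariant subtree `A`. -/
def translationLengthOn {G : Type*} [Group G] {T : Type*} [MetricSpace T] [MulAction G T]
    (A : Set T) (g : G) : ℝ :=
  ⨅ x : A, dist (x : T) (g • (x : T))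

/-- The minimal `G`-invariant subtree. -/
def minSubtree (G : Type*) [Group G] (T : Type*) [MetricSpace T] [MulAction G T] : Set T :=
  ⋂₀ {A : Set T | A.Nonempty ∧ IsSubtree A ∧ ∀ g : G, ∀ x ∈ A, g • x ∈ A}

/-! ### Free groups, reduced words and the boundary `∂F(𝒜)` -/

/-- Two letters of `𝒜^{±1}` are inverse to each other. -/
def LettersInv {ι : Type*} (a b : ι × Bool) : Prop := a.1 = b.1 ∧ a.2 = !b.2

/-- The prefix of length `n` of (the reduced word of) `w`. -/
def gprefix {ι : Type*} [DecidableEq ι] (w : FreeGroup ι) (n : ℕ) : FreeGroup ι :=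
  FreeGroup.mk (w.toWord.take n)

/-- An infinite reduced word in the letters `𝒜^{±1}`: a point of the Gromov boundary
`∂F(𝒜)` of the free group `F(𝒜)`. -/
structure InfWord (ι : Type*) where
  letter : ℕ → ι × Bool
  reduced : ∀ n, ¬ LettersInv (letter n) (letter (n + 1))

/-- The prefix `X_n` of length `n` of an infinite reduced word `X`. -/
def InfWord.prefixN {ι : Type*} (X : InfWord ι) (n : ℕ) : FreeGroup ι :=
  FreeGroup.mk (List.ofFn fun i : Fin n => X.letter i)

/-- The infinite word `X_k⁻¹ X` obtained by deleting the first `k` letters. -/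
def InfWord.shift {ι : Type*} (X : InfWord ι) (k : ℕ) : InfWord ι :=
  ⟨fun n => X.letter (k + n), fun n => X.reduced (k + n)⟩

/-- A sequence `wₙ ∈ F(𝒜)` converges in `F(𝒜) ∪ ∂F(𝒜)` to the infinite word `X` iff
the length of the maximal common prefix of `wₙ` and `X` tends to infinity. -/
def TendstoBoundary {ι : Type*} [DecidableEq ι] (w : ℕ → FreeGroup ι) (X : InfWord ι) : Prop :=
  ∀ k : ℕ, ∀ᶠ n in atTop, (w n).toWord.take k = List.ofFn fun i : Fin k => X.letter i

/-- `Y = w · X` for the left action of `F(𝒜)` on its boundary `∂F(𝒜)`. -/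
def SmulBoundary {ι : Type*} [DecidableEq ι] (w : FreeGroup ι) (X Y : InfWord ι) : Prop :=
  TendstoBoundary (fun n => w * X.prefixN n) Y

/-- The (Cantor set) topology on `∂F(𝒜)`, induced by the product topology on sequences
of letters. -/
instance {ι : Type*} : TopologicalSpace (InfWord ι) :=
  TopologicalSpace.induced (fun X => X.letter)
    (@Pi.topologicalSpace ℕ (fun _ => ι × Bool) fun _ => ⊥)

/-- A non-trivial element of `F(𝒜)` is cyclically reduced if the first letter of its reduced
word is not the inverse of its last letter. -/
def IsCyclicallyReduced {ι : Type*} [DecidableEq ι] (w : FreeGroup ι) : Prop :=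
  w ≠ 1 ∧ ∀ a ∈ w.toWord.head?, ∀ b ∈ w.toWord.getLast?, ¬ LettersInv a b

/-- The dual laminary language `ℒ_𝒜(T)` of an isometric action of `F(𝒜)` on `T`. -/
def dualLanguage (ι : Type*) [DecidableEq ι] (T : Type*) [MetricSpace T]
    [MulAction (FreeGroup ι) T] : Set (FreeGroup ι) :=
  {v | ∀ ε > (0 : ℝ), ∃ u w : FreeGroup ι,
      (u * v * w).toWord = u.toWord ++ v.toWord ++ w.toWord ∧
      IsCyclicallyReduced (u * v * w) ∧
      translationLength (FreeGroup ι) T (u * v * w) < ε}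

/-- The dual laminary language `ℒ_𝒜(T)`, for the action restricted to an invariant
subtree `A`. -/
def dualLanguageOn (ι : Type*) [DecidableEq ι] {T : Type*} [MetricSpace T]
    [MulAction (FreeGroup ι) T] (A : Set T) : Set (FreeGroup ι) :=
  {v | ∀ ε > (0 : ℝ), ∃ u w : FreeGroup ι,
      (u * v * w).toWord = u.toWord ++ v.toWord ++ w.toWord ∧
      IsCyclicallyReduced (u * v * w) ∧
      translationLengthOn A (u * v * w) < ε}

/-! ### Systems of isometries on a compact ℝ-tree -/

/-- A system of isometries `𝒦 = (K, 𝒜)`: a family, indexed by `ι`, of non-empty partial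
isometries of the compact ℝ-tree `K`, i.e. isometries between non-empty closed subtrees. -/
structure SystemOfIsometries (K : Type*) [MetricSpace K] (ι : Type*) where
  pe : ι → PartialEquiv K K
  isom : ∀ i, ∀ x ∈ (pe i).source, ∀ y ∈ (pe i).source, dist (pe i x) (pe i y) = dist x y
  source_subtree : ∀ i, IsClosedSubtree (pe i).source
  target_subtree : ∀ i, IsClosedSubtree (pe i).target

namespace SystemOfIsometries

variable {K : Type*} [MetricSpace K] {ι : Type*} (S : SystemOfIsometries K ι)

/-- The partial isometry associated to a letter in `𝒜^{±1}`. -/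
def letterPE : ι × Bool → PartialEquiv K K
  | (i, true) => S.pe i
  | (i, false) => (S.pe i).symm

/-- The partial isometry `z₁ ∘ z₂ ∘ ⋯ ∘ zₙ` (acting on the right: first `z₁`, then `z₂`, …)
associated to the reduced word `w = z₁ ⋯ zₙ ∈ F(𝒜)`. -/
def wordPE [DecidableEq ι] (w : FreeGroup ι) : PartialEquiv K K :=
  (w.toWord.map S.letterPE).foldl PartialEquiv.trans (PartialEquiv.refl K)

/-- The domain `dom (w)` of the partial isometry associated to `w`. -/
def dom [DecidableEq ι] (w : FreeGroup ι) : Set K := (S.wordPE w).source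

/-- A word is admissible if it is non-empty as a partial isometry of `K`. -/
def Admissible [DecidableEq ι] (w : FreeGroup ι) : Prop := (S.dom w).Nonempty

/-- An infinite word is admissible if all its prefixes are admissible. -/
def AdmissibleInf [DecidableEq ι] (X : InfWord ι) : Prop := ∀ n, S.Admissible (X.prefixN n)

/-- The domain of an infinite word: the intersection of the domains of its prefixes. -/
def domInf [DecidableEq ι] (X : InfWord ι) : Set K := ⋂ n, S.dom (X.prefixN n)

/-- An infinite word `X` is eventually admissible if some suffix `X_k⁻¹ X` is admissible. -/
def EventuallyAdmissible [DecidableEq ι] (X : InfWord ι) : Prop :=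
  ∃ k, S.AdmissibleInf (X.shift k)

/-- The system `𝒦` has independent generators if the (non-empty) domain of every
admissible infinite word consists of exactly one point. -/
def IndependentGenerators [DecidableEq ι] : Prop :=
  ∀ X : InfWord ι, S.AdmissibleInf X → ∃ x : K, S.domInf X = {x}

/-- The admissible laminary language `ℒ_adm(𝒦)`: the largest laminary language consisting of
admissible words; `w ∈ ℒ_adm(𝒦)` iff for every `k` the word `w` is obtained from some
admissible word `v` by deleting its prefix and its suffix of length `k`. -/
def admLanguage [DecidableEq ι] : Set (FreeGroup ι) :=
  {w | ∀ k : ℕ, ∃ v : FreeGroup ι, S.Admissible v ∧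
      ∃ p s : List (ι × Bool), p.length = k ∧ s.length = k ∧
        v.toWord = p ++ w.toWord ++ s}

end SystemOfIsometries

/-- The ℝ-tree `T_𝒦` associated to a system of isometries `𝒦 = (K, 𝒜)`, presented through
its characteristic properties (Theorem 3.2 of the paper, by which it is unique):
`T_𝒦` contains `K` as an isometrically embedded subtree (1); the left action of `F(𝒜)`
is compatible with the partial isometries (2); every orbit meets `K`, and indeed every
segment is covered by finitely many translates of `K` (3); and `T_𝒦` is universal among
trees satisfying (1) and (2), via unique equivariant morphisms (4). -/
structure AssocTree {K : Type} [MetricSpace K] {ι : Type} [DecidableEq ι]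
    (S : SystemOfIsometries K ι) where
  carrier : Type
  [ms : MetricSpace carrier]
  tree : IsRTree carrier
  [act : MulAction (FreeGroup ι) carrier]
  act_isom : ∀ g : FreeGroup ι, Isometry fun x : carrier => g • x
  emb : K → carrier
  emb_isom : Isometry emb
  emb_subtree : IsSubtree (Set.range emb)
  compat : ∀ i : ι, ∀ x ∈ (S.pe i).source, (FreeGroup.of i)⁻¹ • emb x = emb (S.pe i x)
  orbit_meets : ∀ p : carrier, ∃ (w : FreeGroup ι) (x : K), p = w • emb x
  seg_cover : ∀ p q : carrier, ∃ F : Finset (FreeGroup ι),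
      seg p q ⊆ ⋃ w ∈ F, w • Set.range emb
  universal : ∀ (T' : Type) [MetricSpace T'] [MulAction (FreeGroup ι) T'],
      (∀ g : FreeGroup ι, Isometry fun x : T' => g • x) →
      ∀ e' : K → T', Isometry e' →
      (∀ i : ι, ∀ x ∈ (S.pe i).source, (FreeGroup.of i)⁻¹ • e' x = e' (S.pe i x)) →
      ∃! f : carrier → T', IsTreeMorphism f ∧
        (∀ (g : FreeGroup ι) (p : carrier), f (g • p) = g • f p) ∧
        ∀ x : K, f (emb x) = e' x

attribute [instance] AssocTree.ms AssocTree.act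

/-! ### Very small minimal actions with dense orbits, and their metric completion -/

/-- An ℝ-tree `T` (here: the subtree `Tsub` of the complete ℝ-tree `Tb`, whose metric
completion `T̄` is `Tb`) with a very small, minimal, isometric action of the free group
`F(𝒜)` with dense orbits.  (For actions with dense orbits, "very small" is equivalent to
"trivial arc stabilizers".) -/
structure TreeSetup (ι : Type) where
  Tb : Type
  [ms : MetricSpace Tb]
  complete : CompleteSpace Tb
  tree : IsRTree Tb
  [act : MulAction (FreeGroup ι) Tb]
  act_isom : ∀ g : FreeGroup ι, Isometry fun x : Tb => g • x
  Tsub : Set Tb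
  nonempty : Tsub.Nonempty
  dense : Dense Tsub
  sub_subtree : IsSubtree Tsub
  invariant : ∀ g : FreeGroup ι, ∀ x ∈ Tsub, g • x ∈ Tsub
  minimal : ∀ A : Set Tb, A ⊆ Tsub → A.Nonempty → IsSubtree A →
      (∀ g : FreeGroup ι, ∀ x ∈ A, g • x ∈ A) → A = Tsub
  dense_orbits : ∀ x ∈ Tsub, Tsub ⊆ closure (Set.range fun g : FreeGroup ι => g • x)
  arc_stab : ∀ g : FreeGroup ι, ∀ x ∈ Tsub, ∀ y ∈ Tsub, x ≠ y →
      (fun p => g • p) '' seg x y = seg x y → g = 1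

attribute [instance] TreeSetup.ms TreeSetup.act

/-- `𝒬(X) = Q` (for `Q ∈ T̄`), where `𝒬 : ∂F_N → T̂` is the map of Levitt–Lustig:
it is characterized by the property that whenever a sequence `uₙ ∈ F_N` converges to
`X ∈ ∂F_N` and `uₙ P` converges metrically in `T̄` to a point `Q`, then `𝒬(X) = Q`. -/
def QRel {ι : Type} [DecidableEq ι] (St : TreeSetup ι) (X : InfWord ι) (Q : St.Tb) : Prop :=
  ∃ P ∈ St.Tsub, ∃ u : ℕ → FreeGroup ι, TendstoBoundary u X ∧
    Tendsto (fun n => u n • P) atTop (𝓝 Q)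

/-- The limit set `Ω_𝒜 = 𝒬²(C²_𝒜 ∩ L²(T)) ⊆ T̄`: images of pairs of distinct boundary
points with distinct first letters (w.r.t. the basis `𝒜`) that are identified by `𝒬`. -/
def limitSet {ι : Type} [DecidableEq ι] (St : TreeSetup ι) : Set St.Tb :=
  {Q | ∃ X Y : InfWord ι, X.letter 0 ≠ Y.letter 0 ∧ QRel St X Q ∧ QRel St Y Q}

/-- The heart `K_𝒜 ⊆ T̄`: the convex hull of the limit set `Ω_𝒜`. -/
def heart {ι : Type} [DecidableEq ι] (St : TreeSetup ι) : Set St.Tb :=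
  subtreeHull (limitSet St)

/-- The dual algebraic lamination `L²(T) = {(X,Y) ∈ ∂²F_N : 𝒬(X) = 𝒬(Y)}`. -/
def L2 {ι : Type} [DecidableEq ι] (St : TreeSetup ι) : Set (InfWord ι × InfWord ι) :=
  {p | p.1 ≠ p.2 ∧ ∃ Q : St.Tb, QRel St p.1 Q ∧ QRel St p.2 Q}

/-! ### The system of isometries induced on a compact subtree `K ⊆ T̄` -/

/-- The domain, inside `T̄`, of the partial isometry `x ↦ w⁻¹ x` of `K` induced by the word
`w`: the intersection of the translates of `K` by the prefixes of `w`. -/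
def inducedDom {ι : Type} [DecidableEq ι] (St : TreeSetup ι) (K : Set St.Tb)
    (w : FreeGroup ι) : Set St.Tb :=
  ⋂ n ∈ Finset.range (w.toWord.length + 1), gprefix w n • K

/-- Admissibility of a word for the induced system of isometries `𝒦 = (K, 𝒜)`. -/
def InducedAdmissible {ι : Type} [DecidableEq ι] (St : TreeSetup ι) (K : Set St.Tb)
    (w : FreeGroup ι) : Prop :=
  (inducedDom St K w).Nonempty

/-- The admissible laminary language `ℒ_adm(𝒦)` of the induced system `𝒦 = (K, 𝒜)`. -/
def inducedAdmLanguage {ι : Type} [DecidableEq ι] (St : TreeSetup ι) (K : Set St.Tb) :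
    Set (FreeGroup ι) :=
  {w | ∀ k : ℕ, ∃ v : FreeGroup ι, InducedAdmissible St K v ∧
      ∃ p s : List (ι × Bool), p.length = k ∧ s.length = k ∧
        v.toWord = p ++ w.toWord ++ s}

/-- Admissibility of an infinite word for the induced system `𝒦 = (K, 𝒜)`. -/
def InducedAdmissibleInf {ι : Type} [DecidableEq ι] (St : TreeSetup ι) (K : Set St.Tb)
    (X : InfWord ι) : Prop :=
  ∀ n, InducedAdmissible St K (X.prefixN n)

/-- The domain `dom(X) = ⋂ₙ dom(Xₙ)` of an infinite word, for the induced system. -/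
def inducedDomInf {ι : Type} [DecidableEq ι] (St : TreeSetup ι) (K : Set St.Tb)
    (X : InfWord ι) : Set St.Tb :=
  ⋂ n, X.prefixN n • K

/-- Compatibility of a map `e : K → T'` with the system of partial isometries induced on
`K ⊆ T̄` by the basis `𝒜`: this is condition (2) of Theorem 3.2 for the induced system. -/
def InducedCompat {ι : Type} (St : TreeSetup ι) (K : Set St.Tb) {T' : Type} [MetricSpace T']
    [MulAction (FreeGroup ι) T'] (e : K → T') : Prop :=
  ∀ (i : ι) (x : K) (h : (FreeGroup.of i)⁻¹ • (x : St.Tb) ∈ K),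
    (FreeGroup.of i)⁻¹ • e x = e ⟨(FreeGroup.of i)⁻¹ • (x : St.Tb), h⟩

/-- The tree `T_𝒦` associated to the system of isometries induced on a compact subtree
`K ⊆ T̄`, presented through the characteristic properties of Theorem 3.2 (by which it is
unique), together with the canonical `F(𝒜)`-equivariant morphism `j : T_𝒦 → T̄` restricting
to the identity on `K`. -/
structure InducedAssoc {ι : Type} (St : TreeSetup ι) (K : Set St.Tb) where
  TK : Type
  [ms : MetricSpace TK]
  tree : IsRTree TK
  [act : MulAction (FreeGroup ι) TK]
  act_isom : ∀ g : FreeGroup ι, Isometry fun x : TK => g • x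
  emb : K → TK
  emb_isom : Isometry emb
  emb_subtree : IsSubtree (Set.range emb)
  compat : InducedCompat St K emb
  orbit_meets : ∀ p : TK, ∃ (w : FreeGroup ι) (x : K), p = w • emb x
  seg_cover : ∀ p q : TK, ∃ F : Finset (FreeGroup ι),
      seg p q ⊆ ⋃ w ∈ F, w • Set.range emb
  universal : ∀ (T' : Type) [MetricSpace T'] [MulAction (FreeGroup ι) T'],
      (∀ g : FreeGroup ι, Isometry fun x : T' => g • x) →
      ∀ e' : K → T', Isometry e' → InducedCompat St K e' →
      ∃! f : TK → T', IsTreeMorphism f ∧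
        (∀ (g : FreeGroup ι) (p : TK), f (g • p) = g • f p) ∧
        ∀ x : K, f (emb x) = e' x
  jmap : TK → St.Tb
  jmap_morphism : IsTreeMorphism jmap
  jmap_equivariant : ∀ (g : FreeGroup ι) (p : TK), jmap (g • p) = g • jmap p
  jmap_emb : ∀ x : K, jmap (emb x) = (x : St.Tb)

attribute [instance] InducedAssoc.ms InducedAssoc.act

/-! ### Change of basis -/

/-- Changing the basis of the free group: the same tree, with the action precomposed with
the automorphism `φ` of `F(𝒜)`.  The heart of `St.twist φ` is the heart of `T` with respect
to the basis `φ(𝒜)`. -/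
def TreeSetup.twist {ι : Type} (St : TreeSetup ι) (φ : FreeGroup ι ≃* FreeGroup ι) :
    TreeSetup ι where
  Tb := St.Tb
  ms := St.ms
  complete := St.complete
  tree := St.tree
  act := { smul := fun g x => φ g • x
           one_smul := fun x => by show φ 1 • x = x; rw [map_one, one_smul]
           mul_smul := fun g h x => by
             show φ (g * h) • x = φ g • φ h • x
             rw [map_mul, mul_smul] }
  act_isom := fun g => St.act_isom (φ g)
  Tsub := St.Tsub
  nonempty := St.nonempty
  dense := St.dense
  sub_subtree := St.sub_subtree
  invariant := fun g x hx => St.invariant (φ g) x hx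
  minimal := fun A hA hne hsub hinv => St.minimal A hA hne hsub (fun g x hx => by
    have h : φ (φ.symm g) • x ∈ A := hinv (φ.symm g) x hx
    rwa [MulEquiv.apply_symm_apply] at h)
  dense_orbits := fun x hx => by
    have hr : (Set.range fun g : FreeGroup ι => φ g • x) =
        Set.range fun g : FreeGroup ι => g • x := by
      apply Set.ext; intro y
      constructor
      · rintro ⟨g, rfl⟩; exact ⟨φ g, rfl⟩
      · rintro ⟨g, rfl⟩; exact ⟨φ.symm g, by simp⟩
    show St.Tsub ⊆ closure (Set.range fun g : FreeGroup ι => φ g • x)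
    rw [hr]; exact St.dense_orbits x hx
  arc_stab := fun g x hx y hy hxy him => by
    have h1 : φ g = 1 := St.arc_stab (φ g) x hx y hy hxy him
    have h2 := congrArg φ.symm h1
    simpa using h2

/-! ### The boundary `∂T`, the space `T̂ = T̄ ∪ ∂T` and the observers' topology -/

/-- An isometric ray (parametrized on `[0,∞)`) in a metric space. -/
def IsRay {T : Type} [MetricSpace T] (r : ℝ → T) : Prop :=
  ∀ s t : ℝ, 0 ≤ s → 0 ≤ t → dist (r s) (r t) = |s - t|

/-- The type of isometric rays in `T`. -/
def Ray (T : Type) [MetricSpace T] : Type := {r : ℝ → T // IsRay r}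

/-- Two rays define the same end iff they are at bounded distance. -/
def rayEnd (T : Type) [MetricSpace T] : Setoid (Ray T) where
  r := fun r₁ r₂ => ∃ C : ℝ, ∀ t : ℝ, 0 ≤ t → dist (r₁.1 t) (r₂.1 t) ≤ C
  iseqv := by
    refine ⟨fun r => ⟨0, fun t _ => by simp⟩, ?_, ?_⟩
    · rintro r₁ r₂ ⟨C, hC⟩
      exact ⟨C, fun t ht => by rw [dist_comm]; exact hC t ht⟩
    · rintro r₁ r₂ r₃ ⟨C, hC⟩ ⟨D, hD⟩
      exact ⟨C + D, fun t ht =>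
        (dist_triangle _ (r₂.1 t) _).trans (add_le_add (hC t ht) (hD t ht))⟩

/-- The Gromov boundary `∂T`: ends of `T`, i.e. classes of rays at bounded distance. -/
def GromovBoundary (T : Type) [MetricSpace T] : Type := Quotient (rayEnd T)

/-- The space `T̂ = T̄ ∪ ∂T` (for `T` a complete ℝ-tree, representing the completion `T̄`). -/
def TreeHat (T : Type) [MetricSpace T] : Type := T ⊕ GromovBoundary T

/-- The segment `[x, ξ]` from a point `x ∈ T̄` to a boundary point `ξ ∈ ∂T`. -/
def raySeg {T : Type} [MetricSpace T] (x : T) (ξ : GromovBoundary T) : Set (TreeHat T) :=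
  ({Sum.inr ξ} : Set (TreeHat T)) ∪ Sum.inl ''
    {p | ∃ r : Ray T, Quotient.mk (rayEnd T) r = ξ ∧ r.1 0 = x ∧ ∃ t : ℝ, 0 ≤ t ∧ r.1 t = p}

/-- The segment `[ξ, η]` between two boundary points. -/
def lineSeg {T : Type} [MetricSpace T] (ξ η : GromovBoundary T) : Set (TreeHat T) :=
  ({Sum.inr ξ, Sum.inr η} : Set (TreeHat T)) ∪ Sum.inl ''
    {p | ∃ r r' : Ray T, Quotient.mk (rayEnd T) r = ξ ∧ Quotient.mk (rayEnd T) r' = η ∧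
      r.1 0 = p ∧ r'.1 0 = p ∧ ∀ s t : ℝ, 0 ≤ s → 0 ≤ t → dist (r.1 s) (r'.1 t) = s + t}

/-- The segment `[P, Q]` between two points of `T̂ = T̄ ∪ ∂T`. -/
def segHat {T : Type} [MetricSpace T] : TreeHat T → TreeHat T → Set (TreeHat T)
  | Sum.inl x, Sum.inl y => Sum.inl '' seg x y
  | Sum.inl x, Sum.inr ξ => raySeg x ξ
  | Sum.inr ξ, Sum.inl x => raySeg x ξ
  | Sum.inr ξ, Sum.inr η => lineSeg ξ η

/-- The observers' topology on `T̂`: generated by the set of directions, where the direction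
at `P` containing `x` is the set of points `y` with `P ∉ [x,y]` (i.e. the connected component
of `T̂ ∖ {P}` containing `x`). -/
def observersTopology (T : Type) [MetricSpace T] : TopologicalSpace (TreeHat T) :=
  TopologicalSpace.generateFrom
    {D | ∃ P x : TreeHat T, x ≠ P ∧ D = {y | y ≠ P ∧ P ∉ segHat x y}}

/-- The extension to `T̂ = T̄ ∪ ∂T` of an isometric action on `T̄`. -/
def TreeHat.smul {T : Type} [MetricSpace T] {G : Type} [Group G] [MulAction G T]
    (hiso : ∀ g : G, Isometry fun x : T => g • x) (g : G) : TreeHat T → TreeHat T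
  | Sum.inl x => Sum.inl (g • x)
  | Sum.inr ξ => Sum.inr <| Quotient.map'
      (fun r : Ray T => (⟨fun t => g • r.1 t, fun s t hs ht => by
        have h := (hiso g).dist_eq (r.1 s) (r.1 t)
        simpa using h.trans (r.2 s t hs ht)⟩ : Ray T))
      (fun r r' h => by
        obtain ⟨C, hC⟩ := h
        exact ⟨C, fun t ht => by
          have h' := (hiso g).dist_eq (r.1 t) (r'.1 t)
          simpa using h'.le.trans (hC t ht)⟩) ξ

/-! ### Laminations -/

/-- An algebraic lamination (as a set of pairs of boundary points) is closed by diagonal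
leaves. -/
def ClosedByDiagonal {ι : Type} (L : Set (InfWord ι × InfWord ι)) : Prop :=
  ∀ X X' X'' : InfWord ι, (X, X') ∈ L → (X', X'') ∈ L → X = X'' ∨ (X, X'') ∈ L

/-- Invariance of a lamination under the `F(𝒜)`-action on `∂²F(𝒜)`. -/
def InvariantLam {ι : Type} [DecidableEq ι] (L : Set (InfWord ι × InfWord ι)) : Prop :=
  ∀ (w : FreeGroup ι) (X X' Y Y' : InfWord ι), (X, X') ∈ L →
    SmulBoundary w X Y → SmulBoundary w X' Y' → (Y, Y') ∈ L

/-- Invariance of a lamination under the flip map. -/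
def FlipInvariant {ι : Type} (L : Set (InfWord ι × InfWord ι)) : Prop :=
  ∀ X Y : InfWord ι, (X, Y) ∈ L → (Y, X) ∈ L

/-- The dual lamination `L²(T)` is minimal up to diagonal leaves: it contains no proper
non-trivial sublamination that is closed by diagonal leaves. -/
def MinimalUpToDiagonal {ι : Type} [DecidableEq ι] (St : TreeSetup ι) : Prop :=
  ∀ L : Set (InfWord ι × InfWord ι), L ⊆ L2 St → L.Nonempty → IsClosed L →
    InvariantLam L → FlipInvariant L → ClosedByDiagonal L → L = L2 St

end CHL

namespace CHL

/-! ### Extending functions along words -/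

namespace SystemOfIsometries

variable {K : Type} [MetricSpace K] {ι : Type} (S : SystemOfIsometries K ι)

theorem letterPE_source_closedSubtree (a : ι × Bool) :
    IsClosedSubtree (S.letterPE a).source := by
  rcases a with ⟨i, _ | _⟩
  · exact S.target_subtree i
  · exact S.source_subtree i

theorem dist_letterPE (a : ι × Bool) {x y : K} (hx : x ∈ (S.letterPE a).source)
    (hy : y ∈ (S.letterPE a).source) :
    dist (S.letterPE a x) (S.letterPE a y) = dist x y := by
  rcases a with ⟨i, _ | _⟩
  · change dist ((S.pe i).symm x) ((S.pe i).symm y) = _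
    rw [← S.isom i _ ((S.pe i).map_target hx) _ ((S.pe i).map_target hy),
      (S.pe i).right_inv hx, (S.pe i).right_inv hy]
  · exact S.isom i x hx y hy

instance (a : ι × Bool) : Nonempty (S.letterPE a).source :=
  (S.letterPE_source_closedSubtree a).1.to_subtype

theorem isometry_letterPE (a : ι × Bool) :
    Isometry fun c : (S.letterPE a).source => S.letterPE a c :=
  Isometry.of_dist_eq fun c d => S.dist_letterPE a c.2 d.2

/-- Non-negative `1`-Lipschitz functions. -/
def IsHeight {X : Type} [MetricSpace X] (φ : X → ℝ) : Prop :=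
  (∀ x, 0 ≤ φ x) ∧ ∀ x y, φ x ≤ φ y + dist x y

theorem IsHeight.continuous {X : Type} [MetricSpace X] {φ : X → ℝ} (h : IsHeight φ) :
    Continuous φ :=
  (LipschitzWith.of_le_add h.2).continuous

/-- The largest extension to the next copy of `K`, glued along the domain of the letter `a`,
of a function on `K`. -/
def extendStep (φ : K → ℝ) (a : ι × Bool) (y : K) : ℝ :=
  ⨅ c : (S.letterPE a).source, φ c + dist (S.letterPE a c) y

theorem bddBelow_extendStep {φ : K → ℝ} (h : ∀ x, 0 ≤ φ x) (a : ι × Bool) (y : K) :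
    BddBelow (Set.range fun c : (S.letterPE a).source => φ c + dist (S.letterPE a c) y) :=
  ⟨0, by rintro _ ⟨c, rfl⟩; exact add_nonneg (h _) dist_nonneg⟩

theorem isHeight_extendStep {φ : K → ℝ} (h : IsHeight φ) (a : ι × Bool) :
    IsHeight (S.extendStep φ a) := by
  refine ⟨fun y => le_ciInf fun c => add_nonneg (h.1 _) dist_nonneg, fun x y => ?_⟩
  rw [← sub_le_iff_le_add]
  refine le_ciInf fun c => ?_
  have h₁ := ciInf_le (S.bddBelow_extendStep h.1 a x) c
  have h₂ := dist_triangle_right (S.letterPE a c) x y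
  change S.extendStep φ a x ≤ _ at h₁
  linarith

theorem extendStep_apply {φ : K → ℝ} (h : IsHeight φ) (a : ι × Bool) {x : K}
    (hx : x ∈ (S.letterPE a).source) : S.extendStep φ a (S.letterPE a x) = φ x := by
  apply le_antisymm
  · refine (ciInf_le (S.bddBelow_extendStep h.1 a (S.letterPE a x)) ⟨x, hx⟩).trans ?_
    simp
  · refine le_ciInf fun c => ?_
    rw [S.dist_letterPE a c.2 hx, dist_comm]
    exact h.2 x c

theorem exists_extendStep_eq [CompactSpace K] {φ : K → ℝ} (h : IsHeight φ) (a : ι × Bool)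
    (y : K) : ∃ c ∈ (S.letterPE a).source,
      S.extendStep φ a y = φ c + dist (S.letterPE a c) y := by
  have : CompactSpace (S.letterPE a).source :=
    isCompact_iff_compactSpace.1 (S.letterPE_source_closedSubtree a).2.1.isCompact
  have hc : Continuous fun c : (S.letterPE a).source => φ c + dist (S.letterPE a c) y :=
    (h.continuous.comp continuous_subtype_val).add
      ((S.isometry_letterPE a).continuous.dist continuous_const)
  obtain ⟨c, -, hmin⟩ := isCompact_univ.exists_isMinOn Set.univ_nonempty hc.continuousOn
  exact ⟨c, c.2, le_antisymm (ciInf_le (S.bddBelow_extendStep h.1 a y) c)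
    (le_ciInf fun d => hmin (Set.mem_univ d))⟩

/-- The iterated extension of a function on `K` along a word. -/
def extend (φ : K → ℝ) (l : List (ι × Bool)) : K → ℝ :=
  l.foldl S.extendStep φ

@[simp]
theorem extend_nil (φ : K → ℝ) : S.extend φ [] = φ := rfl

theorem extend_append (φ : K → ℝ) (l l' : List (ι × Bool)) :
    S.extend φ (l ++ l') = S.extend (S.extend φ l) l' :=
  List.foldl_append

theorem extend_concat (φ : K → ℝ) (l : List (ι × Bool)) (a : ι × Bool) :
    S.extend φ (l ++ [a]) = S.extendStep (S.extend φ l) a := by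
  rw [extend_append]; rfl

theorem isHeight_extend {φ : K → ℝ} (h : IsHeight φ) (l : List (ι × Bool)) :
    IsHeight (S.extend φ l) := by
  induction l using List.reverseRecOn with
  | nil => exact h
  | append_singleton l a ih => rw [extend_concat]; exact S.isHeight_extendStep ih a

theorem extend_add_le {φ ψ : K → ℝ} (hψ : IsHeight ψ) {m : ℝ}
    (hm : ∀ y, ψ y + m ≤ φ y) (l : List (ι × Bool)) (y : K) :
    S.extend ψ l y + m ≤ S.extend φ l y := by
  induction l using List.reverseRecOn generalizing y with
  | nil => exact hm y
  | append_singleton l a ih =>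
    rw [extend_concat, extend_concat]
    refine le_ciInf fun c => ?_
    have h₁ := ciInf_le (S.bddBelow_extendStep (S.isHeight_extend hψ l).1 a y) c
    have h₂ := ih c
    change S.extendStep (S.extend ψ l) a y ≤ _ at h₁
    linarith

theorem isHeight_zero {X : Type} [MetricSpace X] : IsHeight (0 : X → ℝ) :=
  ⟨fun _ => le_rfl, fun x y => by simp⟩

/-- Heights above the base copy of `K` are superadditive under concatenation. -/
theorem add_le_extend_append {l l' : List (ι × Bool)} {m m' : ℝ}
    (h : ∀ y, m ≤ S.extend 0 l y) (h' : ∀ y, m' ≤ S.extend 0 l' y) (y : K) :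
    m + m' ≤ S.extend 0 (l ++ l') y := by
  rw [extend_append]
  have := S.extend_add_le (φ := S.extend 0 l) (ψ := 0) (m := m) isHeight_zero
    (by simpa using h) l' y
  linarith [h' y]

theorem nsmul_le_extend_replicate {l : List (ι × Bool)} {m : ℝ}
    (h : ∀ y, m ≤ S.extend 0 l y) (n : ℕ) (y : K) :
    n * m ≤ S.extend 0 (List.replicate n l).flatten y := by
  induction n generalizing y with
  | zero => simp
  | succ n ih =>
    rw [List.replicate_succ', List.flatten_concat]
    have := S.add_le_extend_append ih h y
    push_cast
    linarith

theorem mem_target_of_extend_eq_zero [CompactSpace K] {l : List (ι × Bool)} {y : K}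
    (h : S.extend 0 l y = 0) :
    y ∈ ((l.map S.letterPE).foldl PartialEquiv.trans (PartialEquiv.refl K)).target := by
  induction l using List.reverseRecOn generalizing y with
  | nil => simp
  | append_singleton l a ih =>
    have hl := S.isHeight_extend (isHeight_zero (X := K)) l
    obtain ⟨c, hc, hcy⟩ := S.exists_extendStep_eq hl a y
    rw [extend_concat, hcy] at h
    have h₁ := hl.1 c
    have h₂ : 0 ≤ dist (S.letterPE a c) y := dist_nonneg
    obtain rfl : S.letterPE a c = y := dist_eq_zero.1 (by linarith)
    rw [List.map_append, List.foldl_append]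
    simp only [List.map_cons, List.map_nil, List.foldl_cons, List.foldl_nil,
      PartialEquiv.trans_target, Set.mem_inter_iff, Set.mem_preimage]
    refine ⟨(S.letterPE a).map_source hc, ?_⟩
    rw [(S.letterPE a).left_inv hc]
    exact ih (by linarith)

variable [DecidableEq ι]

theorem exists_pos_le_extend_of_not_admissible [CompactSpace K] {g : FreeGroup ι}
    (hg : ¬ S.Admissible g) : ∃ δ > 0, ∀ y, δ ≤ S.extend 0 g.toWord y := by
  have hl := S.isHeight_extend (isHeight_zero (X := K)) g.toWord
  rcases isEmpty_or_nonempty K with _ | _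
  · exact ⟨1, one_pos, fun y => isEmptyElim y⟩
  obtain ⟨y, -, hmin⟩ := isCompact_univ.exists_isMinOn Set.univ_nonempty
    hl.continuous.continuousOn
  refine ⟨_, lt_of_le_of_ne (hl.1 y) fun h => hg ?_, fun z => hmin (Set.mem_univ z)⟩
  exact ⟨_, (S.wordPE g).map_target (S.mem_target_of_extend_eq_zero h.symm)⟩

/-! ### Potentials and the metric they define on the glued copies of `K` -/

/-- A potential: a function on the disjoint union of the copies of `K` indexed by `F(𝒜)`,
`1`-Lipschitz on each copy and compatible with the gluings. -/
structure Potential where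
  toFun : FreeGroup ι → K → ℝ
  le_add_dist : ∀ u x y, toFun u x ≤ toFun u y + dist x y
  compat : ∀ u i, ∀ x ∈ (S.pe i).source, toFun (u * FreeGroup.of i) (S.pe i x) = toFun u x

end SystemOfIsometries

theorem toWord_mul_of_cases {ι : Type} [DecidableEq ι] (u : FreeGroup ι) (i : ι) :
    (u * FreeGroup.of i).toWord = u.toWord ++ [(i, true)] ∨
      u.toWord = (u * FreeGroup.of i).toWord ++ [(i, false)] := by
  rcases List.eq_nil_or_concat' u.toWord with h | ⟨l, ⟨j, b⟩, h⟩
  · left; rw [FreeGroup.toWord_mul, h]; rfl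
  by_cases hb : j = i ∧ b = false
  · right
    obtain ⟨rfl, rfl⟩ := hb
    have hl : FreeGroup.IsReduced l :=
      (h ▸ FreeGroup.isReduced_toWord : FreeGroup.IsReduced (l ++ [(j, false)])).infix
        ⟨[], [(j, false)], by simp⟩
    have hu : u * FreeGroup.of j = FreeGroup.mk l := by
      rw [← FreeGroup.mk_toWord (x := u), h, FreeGroup.of, FreeGroup.mul_mk, ← FreeGroup.reduce.self,
        ← FreeGroup.reduce.self (L := l)]
      congr 1
      apply FreeGroup.reduce.Step.eq
      simpa using FreeGroup.Red.Step.not (L₁ := l) (L₂ := []) (x := j) (b := false)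
    rw [hu, h, FreeGroup.toWord_mk, hl.reduce_eq]
  · left
    rw [FreeGroup.toWord_mul, h, FreeGroup.toWord_of]
    apply FreeGroup.IsReduced.reduce_eq
    rw [List.append_assoc]
    have hr : FreeGroup.IsReduced (l ++ [(j, b)]) := h ▸ FreeGroup.isReduced_toWord
    rw [← List.append_assoc]
    refine hr.append_overlap (L₃ := [(i, true)]) ?_ (by simp)
    refine FreeGroup.isReduced_cons_cons.2 ⟨?_, FreeGroup.IsReduced.singleton⟩
    rintro rfl
    simpa using hb

namespace SystemOfIsometries

variable {K : Type} [MetricSpace K] {ι : Type} (S : SystemOfIsometries K ι)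

/-- The potential extending a height function on the base copy of `K`. -/
def heightPotential [DecidableEq ι] (φ : K → ℝ) (h : IsHeight φ) : S.Potential where
  toFun u := S.extend φ u.toWord
  le_add_dist u := (S.isHeight_extend h _).2
  compat u i x hx := by
    rcases toWord_mul_of_cases u i with hu | hu
    · rw [hu, extend_concat]
      exact S.extendStep_apply (S.isHeight_extend h _) (i, true) hx
    · rw [hu, extend_concat]
      conv_rhs => rw [← (S.pe i).left_inv hx]
      exact (S.extendStep_apply (S.isHeight_extend h _) (i, false)
        ((S.pe i).map_source hx)).symm

namespace Potential

variable {S}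

/-- The translate of a potential. -/
def translate (φ : S.Potential) (g : FreeGroup ι) : S.Potential where
  toFun u := φ.toFun (g * u)
  le_add_dist u := φ.le_add_dist _
  compat u i x hx := by rw [← mul_assoc]; exact φ.compat _ i x hx

theorem abs_sub_le_dist (φ : S.Potential) (u : FreeGroup ι) (x y : K) :
    |φ.toFun u x - φ.toFun u y| ≤ dist x y := by
  rw [abs_sub_le_iff]
  constructor
  · linarith [φ.le_add_dist u x y]
  · linarith [φ.le_add_dist u y x, dist_comm x y]

end Potential

theorem exists_potential_bound [CompactSpace K] (w : FreeGroup ι) :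
    ∃ B, ∀ (φ : S.Potential) (u : FreeGroup ι) (x y : K),
      |φ.toFun u x - φ.toFun (u * w) y| ≤ B := by
  have hD (x y : K) : dist x y ≤ Metric.diam (Set.univ : Set K) :=
    Metric.dist_le_diam_of_mem isCompact_univ.isBounded trivial trivial
  have hof (i : ι) (φ : S.Potential) (u : FreeGroup ι) (x y : K) :
      |φ.toFun u x - φ.toFun (u * FreeGroup.of i) y| ≤
        2 * Metric.diam (Set.univ : Set K) := by
    obtain ⟨c, hc⟩ := (S.source_subtree i).1
    have h₁ := (φ.abs_sub_le_dist u x c).trans (hD _ _)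
    have h₂ := (φ.abs_sub_le_dist (u * FreeGroup.of i) (S.pe i c) y).trans (hD _ _)
    rw [φ.compat u i c hc] at h₂
    linarith [abs_sub_le (φ.toFun u x) (φ.toFun u c) (φ.toFun (u * FreeGroup.of i) y)]
  induction w using FreeGroup.induction_on with
  | C1 => exact ⟨_, fun φ u x y => by rw [mul_one]; exact (φ.abs_sub_le_dist u x y).trans (hD _ _)⟩
  | of i => exact ⟨_, hof i⟩
  | inv_of i _ =>
    refine ⟨2 * Metric.diam (Set.univ : Set K), fun φ u x y => ?_⟩
    rw [abs_sub_comm]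
    simpa using hof i φ (u * (FreeGroup.of i)⁻¹) y x
  | mul v w hv hw =>
    obtain ⟨B, hB⟩ := hv
    obtain ⟨C, hC⟩ := hw
    refine ⟨B + C, fun φ u x y => ?_⟩
    have h₁ := hB φ u x x
    have h₂ := hC φ (u * v) x y
    rw [mul_assoc] at h₂
    linarith [abs_sub_le (φ.toFun u x) (φ.toFun (u * v) x) (φ.toFun (u * (v * w)) y)]

/-- The disjoint union `F(𝒜) × K` of copies of `K`, with the pseudometric defined by all
potentials. -/
def Unfolding (_S : SystemOfIsometries K ι) : Type := FreeGroup ι × K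

namespace Unfolding

variable {S}

theorem bddAbove_potential [CompactSpace K] (p q : S.Unfolding) :
    BddAbove (Set.range fun φ : S.Potential => |φ.toFun p.1 p.2 - φ.toFun q.1 q.2|) := by
  obtain ⟨B, hB⟩ := S.exists_potential_bound (p.1⁻¹ * q.1)
  refine ⟨B, ?_⟩
  rintro _ ⟨φ, rfl⟩
  simpa using hB φ p.1 p.2 q.2

variable [CompactSpace K]

instance : PseudoMetricSpace S.Unfolding where
  dist p q := ⨆ φ : S.Potential, |φ.toFun p.1 p.2 - φ.toFun q.1 q.2|
  dist_self _ := by simp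
  dist_comm p q := by simp only [abs_sub_comm]
  dist_triangle p q r := by
    refine Real.iSup_le (fun φ => ?_) (add_nonneg (Real.iSup_nonneg fun _ => abs_nonneg _)
      (Real.iSup_nonneg fun _ => abs_nonneg _))
    exact (abs_sub_le _ _ _).trans
      (add_le_add (le_ciSup (bddAbove_potential p q) φ) (le_ciSup (bddAbove_potential q r) φ))

theorem abs_sub_le_dist (φ : S.Potential) (p q : S.Unfolding) :
    |φ.toFun p.1 p.2 - φ.toFun q.1 q.2| ≤ dist p q :=
  le_ciSup (bddAbove_potential p q) φ

theorem dist_le {p q : S.Unfolding} {B : ℝ} (hB : 0 ≤ B)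
    (h : ∀ φ : S.Potential, |φ.toFun p.1 p.2 - φ.toFun q.1 q.2| ≤ B) : dist p q ≤ B :=
  Real.iSup_le h hB

instance : MulAction (FreeGroup ι) S.Unfolding where
  smul g p := (g * p.1, p.2)
  one_smul _ := Prod.ext (one_mul _) rfl
  mul_smul _ _ _ := Prod.ext (mul_assoc _ _ _) rfl

theorem dist_smul_le (g : FreeGroup ι) (p q : S.Unfolding) : dist (g • p) (g • q) ≤ dist p q :=
  dist_le dist_nonneg fun φ => abs_sub_le_dist (φ.translate g) p q

theorem isometry_smul (g : FreeGroup ι) : Isometry fun p : S.Unfolding => g • p :=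
  Isometry.of_dist_eq fun p q => le_antisymm (dist_smul_le g p q) <| by
    simpa using dist_smul_le g⁻¹ (g • p) (g • q)

instance : ContinuousConstSMul (FreeGroup ι) S.Unfolding :=
  ⟨fun g => (isometry_smul g).continuous⟩

variable (S) in
/-- The point `x` of the copy of `K` indexed by `u`, in the metric quotient of the unfolding. -/
def point (u : FreeGroup ι) (x : K) : SeparationQuotient S.Unfolding :=
  SeparationQuotient.mk (X := S.Unfolding) (u, x)

theorem smul_point (g u : FreeGroup ι) (x : K) : g • point S u x = point S (g * u) x :=
  (SeparationQuotient.mk_smul (X := S.Unfolding) g (u, x)).symm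

theorem dist_point (u v : FreeGroup ι) (x y : K) :
    dist (point S u x) (point S v y) =
      dist (α := S.Unfolding) (u, x) (v, y) :=
  SeparationQuotient.dist_mk _ _

theorem isometry_point_one [DecidableEq ι] : Isometry (point S 1) := by
  refine Isometry.of_dist_eq fun x y => ?_
  rw [dist_point]
  refine le_antisymm (dist_le dist_nonneg fun φ => φ.abs_sub_le_dist 1 x y) ?_
  have h : IsHeight fun z : K => dist z y :=
    ⟨fun _ => dist_nonneg, fun a b => by linarith [dist_triangle a b y]⟩
  simpa [heightPotential] using abs_sub_le_dist (S.heightPotential _ h)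
    (1, x) (1, y)

theorem isometry_smul_quotient (g : FreeGroup ι) :
    Isometry fun p : SeparationQuotient S.Unfolding => g • p := by
  refine Isometry.of_dist_eq fun p q => ?_
  obtain ⟨p, rfl⟩ := SeparationQuotient.surjective_mk p
  obtain ⟨q, rfl⟩ := SeparationQuotient.surjective_mk q
  rw [← SeparationQuotient.mk_smul, ← SeparationQuotient.mk_smul, SeparationQuotient.dist_mk,
    SeparationQuotient.dist_mk]
  exact (isometry_smul g).dist_eq p q

theorem point_compat (i : ι) (x : K) (hx : x ∈ (S.pe i).source) :
    (FreeGroup.of i)⁻¹ • point S 1 x = point S 1 (S.pe i x) := by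
  rw [smul_point, mul_one, ← dist_eq_zero, dist_point]
  refine le_antisymm (dist_le le_rfl fun φ => ?_) dist_nonneg
  simp [← φ.compat (FreeGroup.of i)⁻¹ i x hx]

end Unfolding

end SystemOfIsometries

/-! ### Maps that do not increase distances -/

/-- A continuous map on an interval that does not increase distances on each member of a finite
closed cover does not increase the distance of the endpoints. -/
theorem dist_le_of_finite_closed_cover {X κ : Type*} [MetricSpace X] {γ : ℝ → X} {L : ℝ}
    (hL : 0 ≤ L) (hγ : ContinuousOn γ (Set.Icc 0 L)) (F : Finset κ) (C : κ → Set ℝ)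
    (hC : ∀ j ∈ F, IsClosed (C j)) (hcov : Set.Icc 0 L ⊆ ⋃ j ∈ F, C j)
    (hdist : ∀ j ∈ F, ∀ s ∈ C j, ∀ t ∈ C j, dist (γ s) (γ t) ≤ |s - t|) :
    dist (γ 0) (γ L) ≤ L := by
  refine image_le_of_liminf_slope_right_le_deriv_boundary (f := fun t => dist (γ 0) (γ t))
    (a := 0) (b := L) (B := id) (B' := fun _ => 1) ((continuous_const.dist continuous_id).comp_continuousOn hγ) (by simp)
    continuousOn_id (fun x _ => hasDerivWithinAt_id x _) ?_ (Set.right_mem_Icc.2 hL)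
  intro x hx r hr
  have hev : ∀ᶠ z in 𝓝[>] x, z ∈ Set.Icc 0 L := by
    filter_upwards [Ioc_mem_nhdsGT hx.2] with z hz using ⟨hx.1.trans hz.1.le, hz.2⟩
  obtain ⟨j, hj, hfreq⟩ : ∃ j ∈ F, ∃ᶠ z in 𝓝[>] x, z ∈ C j := by
    by_contra! hne
    have hall := (Filter.eventually_all_finset F).2 hne
    obtain ⟨z, hz, hz'⟩ := (hev.and hall).exists
    obtain ⟨j, hj, hzj⟩ := Set.mem_iUnion₂.1 (hcov hz)
    exact hz' j hj hzj
  have hxC : x ∈ C j := (hC j hj).mem_of_frequently_of_tendsto hfreq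
    (tendsto_id.mono_left nhdsWithin_le_nhds)
  refine (hfreq.and_eventually self_mem_nhdsWithin).mono fun z ⟨hz, hxz⟩ => ?_
  have hpos : 0 < z - x := sub_pos.2 hxz
  have h₁ := hdist j hj x hxC z hz
  rw [abs_sub_comm, abs_of_pos hpos] at h₁
  rw [slope_def_field, div_lt_iff₀ hpos]
  have h₂ := dist_triangle (γ 0) (γ x) (γ z)
  nlinarith

namespace AssocTree

open SystemOfIsometries

theorem dist_pow_smul_le {K : Type} [MetricSpace K] {ι : Type} [DecidableEq ι]
    {S : SystemOfIsometries K ι} (A : AssocTree S) (g : FreeGroup ι) (p : A.carrier) (n : ℕ) :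
    dist p (g ^ n • p) ≤ n * dist p (g • p) := by
  induction n with
  | zero => simp
  | succ n ih =>
    have h := (A.act_isom (g ^ n)).dist_eq p (g • p)
    simp only [smul_smul, ← pow_succ] at h
    push_cast
    linarith [dist_triangle p (g ^ n • p) (g ^ (n + 1) • p)]

variable {K : Type} [MetricSpace K] [CompactSpace K] {ι : Type} [DecidableEq ι]
  {S : SystemOfIsometries K ι} (A : AssocTree S)

theorem isClosed_smul_range_emb (w : FreeGroup ι) : IsClosed (w • Set.range A.emb) :=
  ((isCompact_range A.emb_isom.continuous).image (A.act_isom w).continuous).isClosed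

/-- Potentials are `1`-Lipschitz on the associated tree. -/
theorem potential_abs_sub_le_dist (φ : S.Potential) (u v : FreeGroup ι) (x y : K) :
    |φ.toFun u x - φ.toFun v y| ≤ dist (u • A.emb x) (v • A.emb y) := by
  obtain ⟨f, ⟨⟨hcont, -⟩, heq, hemb⟩, -⟩ := A.universal (SeparationQuotient S.Unfolding)
    Unfolding.isometry_smul_quotient (Unfolding.point S 1) Unfolding.isometry_point_one
    Unfolding.point_compat
  have hpt (w : FreeGroup ι) (z : K) : f (w • A.emb z) = Unfolding.point S w z := by
    rw [heq, hemb, Unfolding.smul_point, mul_one]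
  refine (Unfolding.abs_sub_le_dist φ (u, x) (v, y)).trans ?_
  rw [← Unfolding.dist_point, ← hpt, ← hpt]
  generalize u • A.emb x = p
  generalize v • A.emb y = q
  obtain ⟨γ, h0, h1, hγ⟩ := A.tree.geodesic p q
  obtain ⟨F, hF⟩ := A.seg_cover p q
  have hγc : ContinuousOn γ (Set.Icc 0 (dist p q)) := by
    refine (LipschitzOnWith.of_dist_le_mul (K := 1) fun s hs t ht => ?_).continuousOn
    rw [hγ s hs t ht, NNReal.coe_one, one_mul, Real.dist_eq]
  have key := dist_le_of_finite_closed_cover (γ := f ∘ γ) dist_nonneg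
    (hcont.comp_continuousOn hγc) F
    (fun w => Set.Icc 0 (dist p q) ∩ γ ⁻¹' (w • Set.range A.emb))
    (fun w _ => hγc.preimage_isClosed_of_isClosed isClosed_Icc (A.isClosed_smul_range_emb w))
    ?_ ?_
  · simpa [h0, h1] using key
  · intro t ht
    have hseg : γ t ∈ seg p q := by
      change dist p (γ t) + dist (γ t) q = dist p q
      have e₁ := hγ 0 ⟨le_rfl, dist_nonneg⟩ t ht
      have e₂ := hγ t ht (dist p q) ⟨dist_nonneg, le_rfl⟩
      rw [h0, zero_sub, abs_neg, abs_of_nonneg ht.1] at e₁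
      rw [h1, abs_sub_comm, abs_of_nonneg (sub_nonneg.2 ht.2)] at e₂
      linarith
    obtain ⟨w, hw, hmem⟩ := Set.mem_iUnion₂.1 (hF hseg)
    exact Set.mem_iUnion₂.2 ⟨w, hw, ht, hmem⟩
  · rintro w - s ⟨hs, hsw⟩ t ⟨ht, htw⟩
    rw [← hγ s hs t ht]
    obtain ⟨_, ⟨a, rfl⟩, ha⟩ := hsw
    obtain ⟨_, ⟨b, rfl⟩, hb⟩ := htw
    change w • A.emb a = γ s at ha
    change w • A.emb b = γ t at hb
    rw [Function.comp_apply, Function.comp_apply, ← ha, ← hb, heq, heq, hemb, hemb,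
      (Unfolding.isometry_smul_quotient w).dist_eq, Unfolding.isometry_point_one.dist_eq,
      (A.act_isom w).dist_eq, A.emb_isom.dist_eq]

/-- If the translate of `K` by a cyclically reduced word has height at least `m`, the corresponding
isometry displaces every point by at least `m`. -/
theorem le_dist_smul [Nonempty K] {g : FreeGroup ι}
    (hg : FreeGroup.IsCyclicallyReduced g.toWord) {m : ℝ}
    (hm : ∀ y, m ≤ S.extend 0 g.toWord y) (p : A.carrier) : m ≤ dist p (g • p) := by
  obtain ⟨z⟩ := ‹Nonempty K›
  by_contra! hlt
  obtain ⟨n, hn⟩ := exists_nat_gt (2 * dist p (A.emb z) / (m - dist p (g • p)))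
  rw [div_lt_iff₀ (sub_pos.2 hlt)] at hn
  have h₁ := A.potential_abs_sub_le_dist (S.heightPotential 0 isHeight_zero) 1 (g ^ n) z z
  have h₂ : S.extend 0 (g ^ n).toWord z ≤ dist (A.emb z) (g ^ n • A.emb z) := by
    rw [one_smul] at h₁
    simpa [heightPotential] using (neg_le_abs _).trans h₁
  rw [FreeGroup.toWord_pow, (hg.flatten_replicate n).isReduced.reduce_eq] at h₂
  have h₃ := S.nsmul_le_extend_replicate hm n z
  have h₄ := dist_triangle4 (A.emb z) p (g ^ n • p) (g ^ n • A.emb z)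
  rw [dist_comm (A.emb z) p, (A.act_isom (g ^ n)).dist_eq] at h₄
  linarith [A.dist_pow_smul_le g p n]

end AssocTree

theorem IsCyclicallyReduced.toWord {ι : Type*} [DecidableEq ι] {w : FreeGroup ι}
    (h : IsCyclicallyReduced w) : FreeGroup.IsCyclicallyReduced w.toWord := by
  refine ⟨FreeGroup.isReduced_toWord, fun a ha b hb hab => ?_⟩
  have := h.2 b hb a ha
  by_contra hne
  exact this ⟨hab.symm, by rwa [Bool.eq_not, ne_comm]⟩

/-- A high enough power of a word containing `l` contains an extension of `l` by `k` letters on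
both sides. -/
theorem exists_extension_in_power {α : Type*} {u l w : List α} (hne : u ++ l ++ w ≠ [])
    (k : ℕ) : ∃ a p s b : List α, p.length = k ∧ s.length = k ∧
      (List.replicate (2 * k + 1) (u ++ l ++ w)).flatten = a ++ (p ++ l ++ s) ++ b := by
  set L := u ++ l ++ w with hLdef
  have hL : 1 ≤ L.length := List.length_pos_iff.2 hne
  have hlen : k ≤ (List.replicate k L).flatten.length := by
    simp only [List.length_flatten, List.map_replicate, List.sum_replicate, smul_eq_mul]
    nlinarith
  set R := (List.replicate k L).flatten
  refine ⟨(R ++ u).take ((R ++ u).length - k), (R ++ u).drop ((R ++ u).length - k),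
    (w ++ R).take k, (w ++ R).drop k, ?_, ?_, ?_⟩
  · simp only [List.length_drop, List.length_append]; omega
  · simp only [List.length_take, List.length_append]; omega
  · have e : (List.replicate (2 * k + 1) L).flatten = R ++ L ++ R := by
      rw [show 2 * k + 1 = k + 1 + k by ring, List.replicate_add, List.replicate_succ',
        List.flatten_append, List.flatten_concat]
    calc _ = (R ++ u) ++ l ++ (w ++ R) := by rw [e, hLdef]; simp only [List.append_assoc]
      _ = ((R ++ u).take ((R ++ u).length - k) ++ (R ++ u).drop ((R ++ u).length - k)) ++ l ++
          ((w ++ R).take k ++ (w ++ R).drop k) := by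
        rw [List.take_append_drop, List.take_append_drop]
      _ = _ := by simp only [List.append_assoc]

/-- **Proposition 3.12.**  For any system of isometries `𝒦 = (K, 𝒜)` with associated
ℝ-tree `T_𝒦`, the dual laminary language of `T_𝒦` is contained in the admissible laminary
language of `𝒦`:  `ℒ_𝒜(T_𝒦) ⊆ ℒ_adm(𝒦)`. -/
theorem dual_subset_admissible (K : Type) [MetricSpace K] [CompactSpace K] [IsRTree K]
    (ι : Type) [Fintype ι] [DecidableEq ι] (S : SystemOfIsometries K ι)
    (A : AssocTree S) :
    dualLanguage ι A.carrier ⊆ S.admLanguage := by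
  intro v hv k
  by_contra! hadm
  have hlists : {l : List (ι × Bool) | l.length = k}.Finite := List.finite_length_eq _ k
  obtain ⟨δ, hδ, hδle⟩ : ∃ δ > 0, ∀ p s : List (ι × Bool), p.length = k → s.length = k →
      FreeGroup.IsReduced (p ++ v.toWord ++ s) →
      ∀ y, δ ≤ S.extend 0 (p ++ v.toWord ++ s) y := by
    have hex (ps : List (ι × Bool) × List (ι × Bool)) : ∃ δ > 0, ps.1.length = k →
        ps.2.length = k → FreeGroup.IsReduced (ps.1 ++ v.toWord ++ ps.2) →
        ∀ y, δ ≤ S.extend 0 (ps.1 ++ v.toWord ++ ps.2) y := by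
      by_cases h : ps.1.length = k ∧ ps.2.length = k ∧
          FreeGroup.IsReduced (ps.1 ++ v.toWord ++ ps.2)
      · obtain ⟨h₁, h₂, h₃⟩ := h
        have hw : (FreeGroup.mk (ps.1 ++ v.toWord ++ ps.2)).toWord =
            ps.1 ++ v.toWord ++ ps.2 := by
          rw [FreeGroup.toWord_mk, h₃.reduce_eq]
        obtain ⟨δ, hδ, hle⟩ := S.exists_pos_le_extend_of_not_admissible
          fun hA => hadm _ hA ps.1 ps.2 h₁ h₂ hw
        rw [hw] at hle
        exact ⟨δ, hδ, fun _ _ _ => hle⟩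
      · exact ⟨1, one_pos, fun h₁ h₂ h₃ => (h ⟨h₁, h₂, h₃⟩).elim⟩
    choose d hd hdle using hex
    rcases ({l : List (ι × Bool) | l.length = k} ×ˢ {l : List (ι × Bool) | l.length = k}
      ).eq_empty_or_nonempty with he | hne
    · refine ⟨1, one_pos, fun p s hp hs => ?_⟩
      have : (p, s) ∈ (∅ : Set (List (ι × Bool) × List (ι × Bool))) := he ▸ ⟨hp, hs⟩
      exact this.elim
    · obtain ⟨q, -, hq⟩ := Set.exists_min_image _ d (hlists.prod hlists) hne
      exact ⟨d q, hd q, fun p s hp hs hr y => (hq (p, s) ⟨hp, hs⟩).trans (hdle (p, s) hp hs hr y)⟩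
  obtain ⟨u, w, hword, hcyc, hlt⟩ := hv (δ / (2 * k + 1)) (by positivity)
  set g := u * v * w
  have hne : u.toWord ++ v.toWord ++ w.toWord ≠ [] := by
    rw [← hword]
    exact fun h => hcyc.1 (FreeGroup.toWord_eq_nil_iff.1 h)
  have : Nonempty K := by
    obtain ⟨a, _⟩ := List.exists_mem_of_ne_nil _ hne
    exact (S.source_subtree a.1).1.to_type
  have : Nonempty A.carrier := this.map A.emb
  obtain ⟨x, hx⟩ := exists_lt_of_ciInf_lt hlt
  have hred := hcyc.toWord.flatten_replicate (2 * k + 1)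
  have hpow : (g ^ (2 * k + 1)).toWord = (List.replicate (2 * k + 1) g.toWord).flatten := by
    rw [FreeGroup.toWord_pow, hred.isReduced.reduce_eq]
  obtain ⟨a, p, s, b, hp, hs, hdec⟩ := exists_extension_in_power hne k
  rw [← hword] at hdec
  have hps : FreeGroup.IsReduced (p ++ v.toWord ++ s) :=
    hred.isReduced.infix ⟨a, b, hdec.symm⟩
  have hge (y : K) : δ ≤ S.extend 0 (g ^ (2 * k + 1)).toWord y := by
    have h0 (l : List (ι × Bool)) : ∀ y, 0 ≤ S.extend 0 l y :=
      (S.isHeight_extend SystemOfIsometries.isHeight_zero l).1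
    have := S.add_le_extend_append (S.add_le_extend_append (h0 a) (hδle p s hp hs hps)) (h0 b) y
    rw [hpow, hdec]
    linarith
  have h₁ := A.le_dist_smul (hpow ▸ hred) hge x
  have h₂ := A.dist_pow_smul_le g x (2 * k + 1)
  rw [lt_div_iff₀ (by positivity)] at hx
  push_cast at h₂
  linarith

end CHL
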